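/- arXiv:math/0409609 — 2 statements merged into one kernel-verified Lean document; each statement's English description precedes it below -/
import Mathlib

section
/- Let X be a topological space and p ∈ X. Then p is a tight point of X if and only if the neighborhood filter N(p) belongs to ker(F_1^{△◊}), i.e., for every set Y and every A ⊆ X × Y, the image filter A N(p) satisfies A N(p) ◊ H for every Fréchet filter H on Y. -/
open Filter Set

universe u

/-- Two filters mesh if all their members intersect, i.e. the filter generated by
pairwise intersections (which is `F ⊓ G` in Mathlib's order) is proper. -/
def Mesh {Z : Type u} (F G : Filter Z) : Prop := Filter.NeBot (F ⊓ G)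

/-- The `△` relation: `F △ H` iff whenever `H` meshes `F` there is a proper countably
based filter refining `F ∨ H` (i.e. `≤ F ⊓ H` in Mathlib's order). -/
def Triangle {Z : Type u} (F H : Filter Z) : Prop :=
  Mesh H F → ∃ L : Filter Z, L.NeBot ∧ L.IsCountablyGenerated ∧ L ≤ F ⊓ H

/-- Fréchet filters: `F △ A` for every subset `A`. -/
def Frechet {Z : Type u} (F : Filter Z) : Prop := ∀ A : Set Z, Triangle F (𝓟 A)

/-- The `◊` relation: `F ◊ H` iff whenever `H` meshes `F` there is a countable set
meshing with `F ∨ H` (i.e. `F ⊓ H`). -/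
def Diamond {Z : Type u} (F H : Filter Z) : Prop :=
  Mesh H F → ∃ A : Set Z, A.Countable ∧ Mesh (𝓟 A) (F ⊓ H)

/-- The image filter `AF` of a filter `F` on `X` under a set `A ⊆ X × Y`:
generated by the sets `A(F) = {y | ∃ x ∈ F, (x, y) ∈ A}`. -/
def imgSet {X Y : Type u} (A : Set (X × Y)) (F : Filter X) : Filter Y :=
  ⨅ f ∈ F, 𝓟 {y | ∃ x ∈ f, (x, y) ∈ A}

/-- A collection `E` of subsets clusters at `p` if every neighborhood of `p` has
infinite intersection with some member of `E`. -/
def Clusters {X : Type u} [TopologicalSpace X] (E : Set (Set X)) (p : X) : Prop :=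
  ∀ U ∈ nhds p, ∃ e ∈ E, (U ∩ e).Infinite

/-- `p` is a tight point if every collection clustering at `p` has a countable
subcollection clustering at `p`. -/
def TightPoint {X : Type u} [TopologicalSpace X] (p : X) : Prop :=
  ∀ E : Set (Set X), Clusters E p → ∃ E' ⊆ E, E'.Countable ∧ Clusters E' p

/-- The image of a set under a relation given as a subset of the product. -/
def relImage {X Y : Type u} (A : Set (X × Y)) (U : Set X) : Set Y :=
  {y | ∃ x ∈ U, (x, y) ∈ A}

lemma mem_imgSet {X Y : Type u} {A : Set (X × Y)} {F : Filter X} {t : Set Y} :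
    t ∈ imgSet A F ↔ ∃ U ∈ F, relImage A U ⊆ t := by
  have hmono : Monotone (relImage A) := fun _ _ h _ ⟨x, hx, hxy⟩ => ⟨x, h hx, hxy⟩
  exact mem_lift'_sets hmono

lemma mesh_iff {Z : Type u} {F G : Filter Z} :
    Mesh F G ↔ ∀ f ∈ F, ∀ g ∈ G, (f ∩ g).Nonempty := by
  rw [Mesh, inf_neBot_iff]

lemma mesh_imgSet_iff {X Y : Type u} {A : Set (X × Y)} {F : Filter X} {H : Filter Y} :
    Mesh H (imgSet A F) ↔ ∀ h ∈ H, ∀ U ∈ F, (h ∩ relImage A U).Nonempty := by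
  rw [mesh_iff]
  refine ⟨fun h s hs U hU => h s hs _ (mem_imgSet.2 ⟨U, hU, Subset.rfl⟩), fun h s hs t ht => ?_⟩
  obtain ⟨U, hU, hUt⟩ := mem_imgSet.1 ht
  exact (h s hs U hU).mono (inter_subset_inter_right _ hUt)

lemma mesh_principal_imgSet_inf_iff {X Y : Type u} {A : Set (X × Y)} {F : Filter X}
    {H : Filter Y} {C : Set Y} :
    Mesh (𝓟 C) (imgSet A F ⊓ H) ↔
      ∀ U ∈ F, ∀ h ∈ H, (C ∩ (relImage A U ∩ h)).Nonempty := by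
  rw [mesh_iff]
  constructor
  · intro hC U hU h hh
    exact hC C (mem_principal_self C) _
      (inter_mem_inf (mem_imgSet.2 ⟨U, hU, Subset.rfl⟩) hh)
  · intro hC s hs t ht
    obtain ⟨a, ha, b, hb, rfl⟩ := mem_inf_iff.1 ht
    obtain ⟨U, hU, hUa⟩ := mem_imgSet.1 ha
    exact (hC U hU b hb).mono
      (inter_subset_inter (mem_principal.1 hs) (inter_subset_inter_left _ hUa))

/-- A Fréchet filter meshing with a set has a sequence in this set converging to it. -/
lemma Frechet.exists_seq {Z : Type u} {H : Filter Z} (hH : Frechet H) {B : Set Z}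
    (hB : Mesh (𝓟 B) H) : ∃ y : ℕ → Z, (∀ n, y n ∈ B) ∧ Tendsto y atTop H := by
  obtain ⟨L, hne, hcg, hL⟩ := hH B hB
  obtain ⟨y, hy⟩ := exists_seq_tendsto L
  obtain ⟨hyH, hyB⟩ := tendsto_inf.1 (hy.mono_right hL)
  obtain ⟨N, hN⟩ := eventually_atTop.1 (tendsto_principal.1 hyB)
  exact ⟨fun n => y (n + N), fun n => hN _ (Nat.le_add_left N n),
    hyH.comp (tendsto_add_atTop_nat N)⟩

lemma TightPoint.diamond_imgSet {X : Type u} [TopologicalSpace X] {p : X} (hp : TightPoint p)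
    {Y : Type u} (A : Set (X × Y)) {H : Filter Y} (hH : Frechet H) :
    Diamond (imgSet A (nhds p)) H := by
  intro hmesh
  rw [mesh_imgSet_iff] at hmesh
  simp only [mesh_principal_imgSet_inf_iff]
  let S : Set X := {x | ∃ D : Set Y, D.Countable ∧ D ⊆ relImage A {x} ∧
    ∀ h ∈ H, (D ∩ h).Nonempty}
  by_cases hS : ∃ x ∈ S, ∀ U ∈ nhds p, x ∈ U
  · obtain ⟨x, ⟨D, hDc, hDA, hDH⟩, hx⟩ := hS
    refine ⟨D, hDc, fun U hU h hh => ?_⟩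
    obtain ⟨y, hyD, hyh⟩ := hDH h hh
    obtain ⟨x', rfl, hxy⟩ := hDA hyD
    exact ⟨y, hyD, ⟨x', hx U hU, hxy⟩, hyh⟩
  push Not at hS
  let E : Set (Set X) := {e | ∃ D : Set Y, D.Countable ∧ ∀ U : Set X, (U ∩ e).Infinite →
    ∀ h ∈ H, (D ∩ (relImage A U ∩ h)).Nonempty}
  have hE : Clusters E p := by
    intro U hU
    by_cases hinf : (U ∩ S).Infinite
    · obtain ⟨e, heS, he, hec⟩ : ∃ e ⊆ U ∩ S, e.Infinite ∧ e.Countable := by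
        let f := hinf.natEmbedding
        refine ⟨range fun n => (f n : X), ?_, ?_, countable_range _⟩
        · rintro _ ⟨n, rfl⟩
          exact (f n).2
        · exact infinite_range_of_injective (Subtype.val_injective.comp f.injective)
      refine ⟨e, ?_, by rwa [inter_eq_right.2 (heS.trans inter_subset_left)]⟩
      choose! D hDc hDA hDH using fun x (hx : x ∈ e) => (heS hx).2
      refine ⟨⋃ x ∈ e, D x, hec.biUnion hDc, fun V hV h hh => ?_⟩
      obtain ⟨x, hxV, hxe⟩ := hV.nonempty
      obtain ⟨y, hyD, hyh⟩ := hDH x hxe h hh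
      obtain ⟨x', rfl, hxy⟩ := hDA x hxe hyD
      exact ⟨y, mem_biUnion hxe hyD, ⟨x', hxV, hxy⟩, hyh⟩
    · rw [not_infinite] at hinf
      choose! V hV hxV using hS
      have hW : U ∩ ⋂ x ∈ U ∩ S, V x ∈ nhds p :=
        inter_mem hU ((biInter_mem hinf).2 fun x hx => hV x hx.2)
      set W := U ∩ ⋂ x ∈ U ∩ S, V x
      have hWS : ∀ x ∈ W, x ∉ S := fun x hx hxS =>
        hxV x hxS (mem_iInter₂.1 hx.2 x ⟨hx.1, hxS⟩)
      obtain ⟨y, hyA, hyH⟩ := hH.exists_seq (B := relImage A W) <| mesh_iff.2 fun s hs h hh => by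
        rw [inter_comm]
        exact (hmesh h hh W hW).mono (inter_subset_inter_right _ hs)
      choose x hxW hxy using hyA
      have hfib : ∀ a, (x ⁻¹' {a}).Finite := by
        intro a
        by_contra hinfa
        obtain ⟨n, rfl⟩ := Set.Infinite.nonempty hinfa
        refine hWS _ (hxW n) ⟨y '' (x ⁻¹' {x n}), (to_countable _).image y, ?_, fun h hh => ?_⟩
        · rintro _ ⟨m, hm, rfl⟩
          exact ⟨x m, hm, hxy m⟩
        · obtain ⟨m, hm, hmh⟩ :=
            ((Nat.frequently_atTop_iff_infinite.2 hinfa).and_eventually (hyH hh)).exists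
          exact ⟨y m, mem_image_of_mem y hm, hmh⟩
      have hpre : ∀ s : Set X, s.Finite → (x ⁻¹' s).Finite := fun s hs =>
        hs.preimage' fun b _ => hfib b
      refine ⟨range x, ⟨range y, countable_range y, fun T hT h hh => ?_⟩, ?_⟩
      · have hTx : (x ⁻¹' T).Infinite := fun hfin =>
          hT (by simpa [image_preimage_eq_inter_range] using hfin.image x)
        obtain ⟨m, hm, hmh⟩ :=
          ((Nat.frequently_atTop_iff_infinite.2 hTx).and_eventually (hyH hh)).exists
        exact ⟨y m, mem_range_self m, ⟨x m, hm, hxy m⟩, hmh⟩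
      · have hUx : range x ⊆ U := by
          rintro _ ⟨n, rfl⟩
          exact (hxW n).1
        rw [inter_eq_right.2 hUx]
        intro hfin
        have := hpre _ hfin
        rw [preimage_range] at this
        exact infinite_univ this
  obtain ⟨E', hE'E, hE'c, hE'⟩ := hp E hE
  choose! D hDc hD using fun e (he : e ∈ E') => hE'E he
  refine ⟨⋃ e ∈ E', D e, hE'c.biUnion hDc, fun U hU h hh => ?_⟩
  obtain ⟨e, he, hUe⟩ := hE' U hU
  obtain ⟨z, hzD, hz⟩ := hD e he U hUe h hh
  exact ⟨z, mem_biUnion he hzD, hz⟩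

/-- The supremum of the cofinite filters on the members `e` of `E`, made disjoint as the
sets `e × {e}`. -/
def cofiniteSum {X : Type u} (E : Set (Set X)) : Filter (X × Set X) :=
  ⨆ e ∈ E, map (fun x => (x, e)) (cofinite ⊓ 𝓟 e)

lemma mem_cofiniteSum {X : Type u} {E : Set (Set X)} {h : Set (X × Set X)} :
    h ∈ cofiniteSum E ↔ ∀ e ∈ E, {x ∈ e | (x, e) ∉ h}.Finite := by
  simp only [cofiniteSum, mem_iSup, mem_map, mem_inf_principal, mem_cofinite]
  refine forall₂_congr fun e _ => ?_
  congr!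
  ext x
  simp

lemma frechet_cofiniteSum {X : Type u} (E : Set (Set X)) : Frechet (cofiniteSum E) := by
  intro B hB
  obtain ⟨e, he, hinf⟩ : ∃ e ∈ E, {x ∈ e | (x, e) ∈ B}.Infinite := by
    by_contra! hfin
    obtain ⟨z, hz, hz'⟩ := mesh_iff.1 hB B (mem_principal_self B) Bᶜ
      (mem_cofiniteSum.2 fun e he => by simpa using hfin e he)
    exact hz' hz
  let f := hinf.natEmbedding
  refine ⟨map (fun n => ((f n : X), e)) atTop, inferInstance, inferInstance, le_inf ?_ ?_⟩
  · intro h hh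
    have hf : Function.Injective fun n => (f n : X) := Subtype.val_injective.comp f.injective
    have hpre := (mem_cofiniteSum.1 hh e he).preimage hf.injOn
    rw [mem_map, ← Nat.cofinite_eq_atTop, mem_cofinite]
    exact hpre.subset fun n hn => ⟨(f n).2.1, hn⟩
  · rw [le_principal_iff, mem_map]
    exact univ_mem' fun n => (f n).2.2

lemma tightPoint_of_diamond_imgSet {X : Type u} [TopologicalSpace X] {p : X}
    (hp : ∀ (Y : Type u) (A : Set (X × Y)) (H : Filter Y), Frechet H →
      Diamond (imgSet A (nhds p)) H) : TightPoint p := by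
  intro E hE
  let A : Set (X × (X × Set X)) := {q | q.1 = q.2.1}
  obtain ⟨C, hCc, hC⟩ := hp _ A _ (frechet_cofiniteSum E) <| mesh_imgSet_iff.2 fun h hh U hU => by
    obtain ⟨e, he, hinf⟩ := hE U hU
    obtain ⟨x, ⟨hxU, hxe⟩, hx⟩ := (hinf.sdiff (mem_cofiniteSum.1 hh e he)).nonempty
    exact ⟨(x, e), by_contra fun hxh => hx ⟨hxe, hxh⟩, x, hxU, rfl⟩
  rw [mesh_principal_imgSet_inf_iff] at hC
  refine ⟨E ∩ Prod.snd '' C, inter_subset_left, (hCc.image _).mono inter_subset_right, ?_⟩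
  intro U hU
  by_contra! hfin
  obtain ⟨⟨x, e⟩, hxC, ⟨x', hx'U, hx'⟩, hx⟩ :=
    hC U hU {z | z.2 ∈ E ∩ Prod.snd '' C ∧ z.1 ∉ U ∨ z.2 ∈ E \ Prod.snd '' C} <|
      mem_cofiniteSum.2 fun e he => by
        by_cases heC : e ∈ Prod.snd '' C
        · refine (hfin e ⟨he, heC⟩).subset fun x hx => ⟨?_, hx.1⟩
          by_contra hxU
          exact hx.2 (Or.inl ⟨⟨he, heC⟩, hxU⟩)
        · exact finite_empty.subset fun x hx => hx.2 (Or.inr ⟨he, heC⟩)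
  rcases hx with hx | hx
  · exact hx.2 (hx' ▸ hx'U)
  · exact hx.2 (mem_image_of_mem Prod.snd hxC)

theorem stmt14 {X : Type u} [TopologicalSpace X] (p : X) :
    TightPoint p ↔
      ∀ (Y : Type u) (A : Set (X × Y)) (H : Filter Y), Frechet H →
        Diamond (imgSet A (nhds p)) H := by
  exact ⟨fun hp _ A _ hH => hp.diamond_imgSet A hH, tightPoint_of_diamond_imgSet⟩
end

section
/- ker(F_1^{◊◊}) ⊆ ker(F_1^{††}): if a filter F on a set X satisfies AF ∈ (F_1^◊)^◊(Y) (i.e., AF ◊ H for every countably tight filter H on Y) for every set Y and every A ⊆ X × Y, then F also satisfies AF ∈ (F_1^†)^†(Y) (i.e., AF † G for every countably fan-tight filter G on Y) for every set Y and every A ⊆ X × Y. -/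
open Filter Set

universe u

/-- Countably tight filters: `F ◊ A` for every subset `A`, i.e. `F ∈ F_1^◊`. -/
def CountablyTight {Z : Type u} (F : Filter Z) : Prop :=
  ∀ A : Set Z, Diamond F (𝓟 A)

/-- The `†` relation on filters: `F † H` iff for every countable family of sets,
each meshing with `F ∨ H` (i.e. `F ⊓ H`), one can pick finite subsets whose union
meshes with `F ∨ H`. -/
def Dagger {Z : Type u} (F H : Filter Z) : Prop :=
  ∀ A : ℕ → Set Z, (∀ n, Mesh (𝓟 (A n)) (F ⊓ H)) →
    ∃ B : ℕ → Set Z, (∀ n, B n ⊆ A n ∧ (B n).Finite) ∧ Mesh (𝓟 (⋃ n, B n)) (F ⊓ H)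

/-- Countably fan-tight filters: `F † A` for every subset `A`, i.e. `F ∈ F_1^†`. -/
def CountablyFanTight {Z : Type u} (F : Filter Z) : Prop :=
  ∀ A : Set Z, Dagger F (𝓟 A)

theorem mesh_principal_iff_frequently {Z : Type u} (S : Set Z) (G : Filter Z) :
    Mesh (𝓟 S) G ↔ ∃ᶠ z in G, z ∈ S := by
  rw [Mesh, inf_comm, frequently_mem_iff_neBot]

theorem frequently_inf_imgSet {X Z : Type u} (A : Set (X × Z)) (F : Filter X) (G : Filter Z)
    (p : Z → Prop) :
    (∃ᶠ z in imgSet A F ⊓ G, p z) ↔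
      ∀ f ∈ F, ∃ᶠ z in G, p z ∧ ∃ x ∈ f, (x, z) ∈ A := by
  have hmono : Monotone fun f : Set X => {z | ∃ x ∈ f, (x, z) ∈ A} :=
    fun _ _ hst _ ⟨x, hx, hA⟩ => ⟨x, hst hx, hA⟩
  have hb : (imgSet A F).HasBasis (fun f => f ∈ F) fun f => {z | ∃ x ∈ f, (x, z) ∈ A} :=
    F.basis_sets.lift' hmono
  rw [(hb.inf G.basis_sets).frequently_iff]
  constructor
  · intro h f hf
    rw [frequently_iff]
    intro U hU
    obtain ⟨z, ⟨hz, hzU⟩, hp⟩ := h (i := (f, U)) ⟨hf, hU⟩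
    exact ⟨z, hzU, hp, hz⟩
  · rintro h ⟨f, U⟩ ⟨hf, hU⟩
    obtain ⟨z, hzU, hp, hz⟩ := frequently_iff.1 (h f hf) hU
    exact ⟨z, ⟨hz, hzU⟩, hp⟩

/-- The trace of `G` on the tails `⋃ n ≥ k, B n` of a sequence of sets. -/
def tailTrace {Y : Type u} (G : Filter Y) (B : ℕ → Set Y) : Filter Y :=
  G ⊓ ⨅ k : ℕ, 𝓟 (⋃ n ≥ k, B n)

theorem eventually_tailTrace {Y : Type u} (G : Filter Y) (B : ℕ → Set Y) (k : ℕ) :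
    ∀ᶠ y in tailTrace G B, ∃ n ≥ k, y ∈ B n := by
  have h : tailTrace G B ≤ 𝓟 (⋃ n ≥ k, B n) := inf_le_right.trans (iInf_le _ k)
  filter_upwards [le_principal_iff.1 h] with y hy
  simpa using hy

theorem frequently_tailTrace {Y : Type u} {G : Filter Y} {B : ℕ → Set Y} {p : Y → Prop}
    (h : ∀ k, ∃ᶠ y in G, p y ∧ ∃ n ≥ k, y ∈ B n) : ∃ᶠ y in tailTrace G B, p y := by
  have hanti : Antitone fun k : ℕ => ⋃ n ≥ k, B n := fun k l hkl =>
    biUnion_subset_biUnion_left fun n (hn : l ≤ n) => hkl.trans hn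
  have hb := G.basis_sets.inf (hasBasis_iInf_principal hanti.directed_ge)
  rw [tailTrace, hb.frequently_iff]
  rintro ⟨U, k⟩ ⟨hU, -⟩
  obtain ⟨y, hyU, hp, n, hn, hy⟩ := frequently_iff.1 (h k) hU
  exact ⟨y, ⟨hyU, mem_biUnion hn hy⟩, hp⟩

/-- The sum of a family of filters on `Y`, as a filter on `I × Y`. -/
def sumFilter {I Y : Type u} (H : I → Filter Y) : Filter (I × Y) :=
  ⨆ i, map (Prod.mk i) (H i)

theorem frequently_sumFilter {I Y : Type u} (H : I → Filter Y) (p : I × Y → Prop) :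
    (∃ᶠ z in sumFilter H, p z) ↔ ∃ i, ∃ᶠ y in H i, p (i, y) := by
  simp [sumFilter, frequently_iSup, frequently_map]

theorem countablyTight_sumFilter {I Y : Type u} (H : I → Filter Y) (C : I → Set Y)
    (hC : ∀ i, (C i).Countable) (hH : ∀ i, C i ∈ H i) : CountablyTight (sumFilter H) := by
  intro E hE
  rw [mesh_principal_iff_frequently, frequently_sumFilter] at hE
  obtain ⟨i, hi⟩ := hE
  refine ⟨Prod.mk i '' C i, (hC i).image _, ?_⟩
  rw [mesh_principal_iff_frequently, frequently_inf_principal, frequently_sumFilter]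
  refine ⟨i, (hi.and_eventually (hH i)).mono ?_⟩
  rintro y ⟨hy, hyC⟩
  exact ⟨hy, mem_image_of_mem _ hyC⟩

theorem CountablyFanTight.exists_frequently_tailTrace {Y : Type u} {G : Filter Y}
    (hG : CountablyFanTight G) {D : Set Y} {A : ℕ → Set Y}
    (h : ∀ n, ∃ᶠ y in G, y ∈ A n ∧ y ∈ D) :
    ∃ B : ℕ → Set Y, (∀ n, B n ⊆ A n ∧ (B n).Finite) ∧ ∃ᶠ y in tailTrace G B, y ∈ D := by
  have key : ∀ k : ℕ, ∃ B : ℕ → Set Y, (∀ n, B n ⊆ A (n + k) ∧ (B n).Finite) ∧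
      Mesh (𝓟 (⋃ n, B n)) (G ⊓ 𝓟 D) := fun k => hG D (fun n => A (n + k)) fun n => by
    rw [mesh_principal_iff_frequently, frequently_inf_principal]
    exact (h (n + k)).mono fun y hy => hy.symm
  choose B hB hmesh using key
  refine ⟨fun n => ⋃ k ∈ Iic n, B k (n - k), fun n => ⟨?_, ?_⟩, ?_⟩
  · refine iUnion₂_subset fun k (hk : k ≤ n) => ?_
    simpa [Nat.sub_add_cancel hk] using (hB k (n - k)).1
  · exact (finite_Iic n).biUnion fun k _ => (hB k (n - k)).2
  · refine frequently_tailTrace fun k => ?_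
    have hk := hmesh k
    rw [mesh_principal_iff_frequently, frequently_inf_principal] at hk
    refine hk.mono ?_
    rintro y ⟨hyD, hy⟩
    obtain ⟨n, hn⟩ := mem_iUnion.1 hy
    refine ⟨hyD, n + k, Nat.le_add_left k n, mem_biUnion (x := k) (Nat.le_add_left k n) ?_⟩
    simpa using hn

/-- `ker(F_1^{◊◊}) ⊆ ker(F_1^{††})`. -/
theorem stmt18 {X : Type u} (F : Filter X)
    (h : ∀ (Y : Type u) (A : Set (X × Y)) (H : Filter Y), CountablyTight H →
      Diamond (imgSet A F) H) :
    ∀ (Y : Type u) (A : Set (X × Y)) (G : Filter Y), CountablyFanTight G →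
      Dagger (imgSet A F) G := by
  intro Y R G hG A hA
  simp only [mesh_principal_iff_frequently, frequently_inf_imgSet] at hA ⊢
  -- Test `F` against the sum of the tail traces of `G` over all finite selections from `A`.
  let I : Type u := {B : ℕ → Set Y // ∀ n, B n ⊆ A n ∧ (B n).Finite}
  let H : Filter (I × Y) := sumFilter fun B => tailTrace G B.1
  have hH : CountablyTight H := by
    refine countablyTight_sumFilter _ (fun B => ⋃ n, B.1 n)
      (fun B => countable_iUnion fun n => (B.2 n).2.countable) fun B => ?_
    filter_upwards [eventually_tailTrace G B.1 0] with y ⟨n, _, hy⟩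
    exact mem_iUnion_of_mem n hy
  have hmesh : Mesh H (imgSet {p : X × (I × Y) | (p.1, p.2.2) ∈ R} F) := by
    have : ∃ᶠ _ in imgSet {p : X × (I × Y) | (p.1, p.2.2) ∈ R} F ⊓ H, True := by
      refine (frequently_inf_imgSet _ _ _ _).2 fun f hf => ?_
      obtain ⟨B, hB, hfr⟩ := hG.exists_frequently_tailTrace
        (D := {y | ∃ x ∈ f, (x, y) ∈ R}) fun n => hA n f hf
      exact (frequently_sumFilter _ _).2 ⟨⟨B, hB⟩, hfr.mono fun y hy => ⟨trivial, hy⟩⟩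
    rw [frequently_true_iff_neBot, inf_comm] at this
    exact this
  obtain ⟨C, hC, hCmesh⟩ := h _ _ H hH hmesh
  rw [mesh_principal_iff_frequently, frequently_inf_imgSet] at hCmesh
  have hne : (Prod.fst '' C).Nonempty :=
    let ⟨z, hz, _⟩ := (hCmesh univ univ_mem).exists
    ⟨z.1, mem_image_of_mem _ hz⟩
  obtain ⟨e, he⟩ := (hC.image Prod.fst).exists_eq_range hne
  refine ⟨fun n => ⋃ i ∈ Iic n, (e i).1 n, fun n => ⟨?_, ?_⟩, fun f hf => ?_⟩
  · exact iUnion₂_subset fun i _ => ((e i).2 n).1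
  · exact (finite_Iic n).biUnion fun i _ => ((e i).2 n).2
  · obtain ⟨B, hB⟩ := (frequently_sumFilter _ _).1 (hCmesh f hf)
    obtain ⟨y, hy, -⟩ := hB.exists
    obtain ⟨i, rfl⟩ : B ∈ range e := he ▸ mem_image_of_mem Prod.fst hy
    refine Frequently.filter_mono ?_ (inf_le_left : tailTrace G (e i).1 ≤ G)
    refine (hB.and_eventually (eventually_tailTrace G _ i)).mono ?_
    rintro y ⟨⟨-, hyR⟩, n, hn, hyn⟩
    exact ⟨mem_iUnion_of_mem n (mem_biUnion (x := i) hn hyn), hyR⟩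
end
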